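/- arXiv:2303.11999 — 2 statements merged into one kernel-verified Lean document; each statement's English description precedes it below -/
import Mathlib

section
/- Let n ≥ 1, ℓ ≥ 1, λ ∈ P⁺, and for 1 ≤ a < b ≤ n+1 say that E(a,b) holds if m_{ε_a−ε_b} = ℓ. Let (k_1,…,k_i) and (g_1,…,g_i) be tuples of indices in {1,…,n+1}, each with pairwise distinct entries, such that for every d ∈ {1,…,i}, k_d ≠ g_d and E(min(k_d,g_d), max(k_d,g_d)) holds. Assume moreover that for all p, s ∈ {1,…,i}: if g_p < k_s and E(g_p, k_s) holds then g_p ∈ {k_1,…,k_i}, and if k_s < g_p and E(k_s, g_p) holds then k_s ∈ {g_1,…,g_i}. Then {k_1,…,k_i} = {g_1,…,g_i}. -/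
noncomputable section

namespace DemazurePaper

/-- Integral weights of `sl_{n+1}` in fundamental-weight coordinates. -/
abbrev Wt (n : ℕ) := Fin n → ℤ

/-- Dominant integral weights. -/
def IsDominant {n : ℕ} (μ : Wt n) : Prop := ∀ j, 0 ≤ μ j

/-- coordinates of a weight, extended by zero -/
def wtc {n : ℕ} (μ : Wt n) (r : ℕ) : ℤ := if h : r < n then μ ⟨r, h⟩ else 0

/-- `μ(h_α)` for the root `α = ε_{a+1} - ε_{b+1}` (0-indexed, `a < b`);
equivalently `μ(h_{a+1,b})` for the positive root `α_{a+1,b}`. -/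
def pairing {n : ℕ} (μ : Wt n) (a b : ℕ) : ℤ := ∑ r ∈ Finset.Ico a b, wtc μ r

/-- `s_α`, determined by `μ(h_α) = (s_α - 1)ℓ + m_α`, `1 ≤ m_α ≤ ℓ`. -/
def svalI (ℓ : ℕ) (N : ℤ) : ℕ := if N.toNat % ℓ = 0 then N.toNat / ℓ else N.toNat / ℓ + 1

/-- `m_α`, determined by `μ(h_α) = (s_α - 1)ℓ + m_α`, `1 ≤ m_α ≤ ℓ`. -/
def mvalI (ℓ : ℕ) (N : ℤ) : ℕ := if N.toNat % ℓ = 0 then ℓ else N.toNat % ℓ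

/-- `m_{ε_a − ε_b}` (0-indexed `a < b`) for the weight `μ` and divisor `ℓ` -/
def mRoot {n : ℕ} (ℓ : ℕ) (μ : Wt n) (a b : ℕ) : ℕ := mvalI ℓ (pairing μ a b)

/-- `s_{ε_a − ε_b}` (0-indexed `a < b`) for the weight `μ` and divisor `ℓ` -/
def sRoot {n : ℕ} (ℓ : ℕ) (μ : Wt n) (a b : ℕ) : ℕ := svalI ℓ (pairing μ a b)


theorem range_eq_of_fiberwise {ι α β : Type*} [Finite ι] (c : α → β) (k g : ι → α)
    (hk : Function.Injective k) (hg : Function.Injective g) (hc : ∀ d, c (k d) = c (g d))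
    (h : ∀ p s, c (g p) = c (k s) → g p ∈ Set.range k ∨ k s ∈ Set.range g) :
    Set.range k = Set.range g := by
  classical
  have key : Set.range k ⊆ Set.range g := by
    rintro _ ⟨s, rfl⟩
    by_contra hs
    let F : Set ι := {d | c (k d) = c (k s)}
    have hsub : g '' F ⊆ k '' F := by
      rintro _ ⟨p, hp, rfl⟩
      have hps : c (g p) = c (k s) := (hc p).symm.trans hp
      obtain ⟨q, hq⟩ := (h p s hps).resolve_right hs
      exact ⟨q, (congrArg c hq).trans hps, hq⟩
    have heq : g '' F = k '' F :=
      Set.eq_of_subset_of_ncard_le hsub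
        (by rw [Set.ncard_image_of_injective _ hk, Set.ncard_image_of_injective _ hg])
        (Set.toFinite _)
    have hmem : k s ∈ g '' F := heq ▸ Set.mem_image_of_mem k rfl
    exact hs (Set.image_subset_range g F hmem)
  refine Set.eq_of_subset_of_ncard_le key ?_ (Set.toFinite _)
  rw [← Set.image_univ, ← Set.image_univ, Set.ncard_image_of_injective _ hk,
    Set.ncard_image_of_injective _ hg]

theorem mvalI_eq_iff_dvd {ℓ : ℕ} (hl : 1 ≤ ℓ) {N : ℤ} (hN : 0 ≤ N) :
    mvalI ℓ N = ℓ ↔ (ℓ : ℤ) ∣ N := by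
  lift N to ℕ using hN
  rw [Int.natCast_dvd_natCast, Nat.dvd_iff_mod_eq_zero, mvalI, Int.toNat_natCast]
  have := Nat.mod_lt N hl
  split_ifs with h
  · simp [h]
  · simp only [h, iff_false]
    omega

theorem pairing_nonneg {n : ℕ} {μ : Wt n} (hμ : IsDominant μ) (a b : ℕ) :
    0 ≤ pairing μ a b := by
  refine Finset.sum_nonneg fun r _ => ?_
  rw [wtc]
  split_ifs
  · exact hμ _
  · exact le_rfl

/-- `m_{ε_a − ε_b} = ℓ` says that the partial sums of `μ` up to `a` and `b` agree
modulo `ℓ`. -/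
theorem mRoot_eq_iff {n ℓ : ℕ} (hl : 1 ≤ ℓ) {μ : Wt n} (hμ : IsDominant μ) {a b : ℕ}
    (hab : a ≤ b) :
    mRoot ℓ μ a b = ℓ ↔ pairing μ 0 a % (ℓ : ℤ) = pairing μ 0 b % (ℓ : ℤ) := by
  have hsum : pairing μ 0 a + pairing μ a b = pairing μ 0 b :=
    Finset.sum_Ico_consecutive _ (Nat.zero_le a) hab
  rw [mRoot, mvalI_eq_iff_dvd hl (pairing_nonneg hμ a b),
    show pairing μ a b = pairing μ 0 b - pairing μ 0 a by omega]
  exact Int.modEq_iff_dvd.symm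

/-- **STATEMENT 10.**  Let `n ≥ 1`, `ℓ ≥ 1`, `λ ∈ P⁺`, and say that `E(a,b)` holds for
indices `a < b` of `{1,…,n+1}` (0-indexed here as elements of `Fin (n+1)`) if
`m_{ε_a − ε_b} = ℓ`.  If `(k_1,…,k_i)` and `(g_1,…,g_i)` are tuples of pairwise
distinct indices such that for every `d` the pair `{k_d, g_d}` satisfies `k_d ≠ g_d`
and `E(min(k_d,g_d), max(k_d,g_d))`, and moreover every `g_p < k_s` with `E(g_p,k_s)`
forces `g_p ∈ {k_1,…,k_i}` and every `k_s < g_p` with `E(k_s,g_p)` forces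
`k_s ∈ {g_1,…,g_i}`, then the two index sets coincide. -/
theorem index_sets_equal
    (n ℓ i : ℕ) (hn : 1 ≤ n) (hl : 1 ≤ ℓ)
    (lam : Wt n) (hlam : IsDominant lam)
    (k g : Fin i → Fin (n+1))
    (hk : Function.Injective k) (hg : Function.Injective g)
    (hpair : ∀ d : Fin i, k d ≠ g d ∧
      mRoot ℓ lam (min (k d).val (g d).val) (max (k d).val (g d).val) = ℓ)
    (hgk : ∀ p s : Fin i, g p < k s → mRoot ℓ lam (g p).val (k s).val = ℓ →
      g p ∈ Set.range k)
    (hkg : ∀ p s : Fin i, k s < g p → mRoot ℓ lam (k s).val (g p).val = ℓ →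
      k s ∈ Set.range g) :
    Set.range k = Set.range g := by
  refine range_eq_of_fiberwise (fun x : Fin (n+1) => pairing lam 0 x.val % (ℓ : ℤ)) k g hk hg
    (fun d => ?_) (fun p s hps => ?_)
  · have hd := (hpair d).2
    rw [mRoot_eq_iff hl hlam min_le_max] at hd
    rcases le_total (k d).val (g d).val with h | h
    · rwa [min_eq_left h, max_eq_right h] at hd
    · rw [min_eq_right h, max_eq_left h] at hd
      exact hd.symm
  · rcases lt_trichotomy (g p) (k s) with h | h | h
    · exact Or.inl (hgk p s h ((mRoot_eq_iff hl hlam h.le).2 hps))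
    · exact Or.inl ⟨s, h.symm⟩
    · exact Or.inr (hkg p s h ((mRoot_eq_iff hl hlam h.le).2 hps.symm))

end DemazurePaper
end
end

section
/- For every λ ∈ P⁺, ℓ ≥ 1, i ∈ {1,…,n} and α, β ∈ R_i⁺: if α ⪰ β in the (λ,i)-poset, then m_α ≥ m_β. -/
noncomputable section

namespace DemazurePaper

/-- Positive roots of `sl_{n+1}` encoded as intervals: the pair `(a,b)` with
`1 ≤ a ≤ b ≤ n` encodes `α_{a,b} = ε_a − ε_{b+1}`, with support `{a,…,b}`. -/
abbrev Intv := ℕ × ℕ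

/-- `(a,b)` encodes a positive root `α_{a,b}` -/
def IsPosRoot (n : ℕ) (p : Intv) : Prop := 1 ≤ p.1 ∧ p.1 ≤ p.2 ∧ p.2 ≤ n

/-- membership in `R_i⁺ = {α ∈ R⁺ : ϖ_i(h_α) = 1}` -/
def InRi (n i : ℕ) (p : Intv) : Prop := IsPosRoot n p ∧ p.1 ≤ i ∧ i ≤ p.2

/-- `m_α` for the positive root `α = α_{a,b}` encoded by the interval `p = (a,b)` -/
def mIv {n : ℕ} (ℓ : ℕ) (μ : Wt n) (p : Intv) : ℕ := mvalI ℓ (pairing μ (p.1 - 1) p.2)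

/-- `α ∪ β`: the root supported on `supp(α) ∪ supp(β)` -/
def cupR (p q : Intv) : Intv := (min p.1 q.1, max p.2 q.2)

/-- `α ∩ β`: the root supported on `supp(α) ∩ supp(β)` -/
def capR (p q : Intv) : Intv := (max p.1 q.1, min p.2 q.2)

/-- `α − β ∈ R` for `α ≠ β` in `R_i⁺`: the intervals share exactly one endpoint -/
def DiffIsRoot (p q : Intv) : Prop := (p.1 = q.1 ∧ p.2 ≠ q.2) ∨ (p.2 = q.2 ∧ p.1 ≠ q.1)

/-- the root `(α∪β) − (α∩β)` in case `α − β ∈ R` -/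
def cupSubCap (p q : Intv) : Intv :=
  if p.1 = q.1 then (min p.2 q.2 + 1, max p.2 q.2) else (min p.1 q.1, max p.1 q.1 - 1)

/-- the left flanking root `γ₁` of `supp(α∩β)` inside `supp(α∪β)` -/
def gamma1 (p q : Intv) : Intv := ((cupR p q).1, (capR p q).1 - 1)

/-- the right flanking root `γ₂` of `supp(α∩β)` inside `supp(α∪β)` -/
def gamma2 (p q : Intv) : Intv := ((capR p q).2 + 1, (cupR p q).2)

/-- the root `(α∪β) − α` in case `α∩β ∉ {α,β}` -/
def cupSubFst (p q : Intv) : Intv :=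
  if q.1 < p.1 then (q.1, p.1 - 1) else (p.2 + 1, q.2)

/-- The `(λ,i)`-poset relation `α ⪰ β` on `R_i⁺` (Definition 5.2 of the paper). -/
def PosetGE {n : ℕ} (ℓ : ℕ) (μ : Wt n) (p q : Intv) : Prop :=
  p = q ∨
  -- (i) `α − β ∈ R`
  (DiffIsRoot p q ∧
    (mIv ℓ μ (cupR p q) : ℤ) =
      mIv ℓ μ (capR p q) + mIv ℓ μ (cupSubCap p q) -
        ℓ * (if p = capR p q then 1 else 0)) ∨
  -- (ii) `α − β ∉ R` and `α∩β ∈ {α, β}`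
  (¬ DiffIsRoot p q ∧ (capR p q = p ∨ capR p q = q) ∧
    (mIv ℓ μ (cupR p q) : ℤ) =
      mIv ℓ μ (capR p q) + mIv ℓ μ (gamma1 p q) + mIv ℓ μ (gamma2 p q) -
        2 * ℓ * (if p = capR p q then 1 else 0)) ∨
  -- (iii) `α − β ∉ R` and `α∩β ∉ {α, β}`
  (¬ DiffIsRoot p q ∧ ¬ (capR p q = p ∨ capR p q = q) ∧
    (mIv ℓ μ (cupR p q) : ℤ) = mIv ℓ μ p + mIv ℓ μ (cupSubFst p q) - ℓ ∧
    (mIv ℓ μ (cupR p q) : ℤ) = mIv ℓ μ q + mIv ℓ μ (cupSubFst q p))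


theorem mIv_le {n ℓ : ℕ} (hl : 1 ≤ ℓ) (μ : Wt n) (p : Intv) : mIv ℓ μ p ≤ ℓ := by
  unfold mIv mvalI
  split_ifs
  · exact le_rfl
  · exact (Nat.mod_lt _ hl).le

theorem cupR_eq_right_of_capR_eq_left {p q : Intv} (h : capR p q = p) : cupR p q = q := by
  simp only [capR, cupR, Prod.ext_iff] at h ⊢
  omega

theorem cupR_eq_left_of_capR_eq_right {p q : Intv} (h : capR p q = q) : cupR p q = p := by
  simp only [capR, cupR, Prod.ext_iff] at h ⊢
  omega

theorem DiffIsRoot.capR_eq {p q : Intv} (h : DiffIsRoot p q) : capR p q = p ∨ capR p q = q := by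
  simp only [DiffIsRoot, capR, Prod.ext_iff] at h ⊢
  omega

/-- **STATEMENT 12.**  For every `λ ∈ P⁺`, `ℓ ≥ 1`, `i ∈ {1,…,n}` and `α, β ∈ R_i⁺`:
if `α ⪰ β` in the `(λ,i)`-poset, then `m_α ≥ m_β`. -/
theorem poset_ge_implies_m_ge
    (n ℓ i : ℕ) (hn : 1 ≤ n) (hl : 1 ≤ ℓ) (hi : 1 ≤ i) (hin : i ≤ n)
    (lam : Wt n) (hlam : IsDominant lam)
    (p q : Intv) (hp : InRi n i p) (hq : InRi n i q)
    (hpq : PosetGE ℓ lam p q) :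
    mIv ℓ lam q ≤ mIv ℓ lam p := by
  have bound := mIv_le hl lam
  rcases hpq with rfl | ⟨hd, h⟩ | ⟨-, hc, h⟩ | ⟨-, -, h, h'⟩
  · exact le_rfl
  · have := bound (cupSubCap p q)
    by_cases hc : capR p q = p
    · rw [cupR_eq_right_of_capR_eq_left hc, hc, if_pos rfl] at h
      omega
    · have hcq := hd.capR_eq.resolve_left hc
      rw [if_neg (Ne.symm hc), cupR_eq_left_of_capR_eq_right hcq, hcq] at h
      omega
  · have := bound (gamma1 p q)
    have := bound (gamma2 p q)
    by_cases hcp : capR p q = p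
    · rw [cupR_eq_right_of_capR_eq_left hcp, hcp, if_pos rfl] at h
      omega
    · have hcq := hc.resolve_left hcp
      rw [if_neg (Ne.symm hcp), cupR_eq_left_of_capR_eq_right hcq, hcq] at h
      omega
  · have := bound (cupSubFst p q)
    omega

end DemazurePaper
end
end
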